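/- For every natural number k ≥ 1, every field F, and every m × n stencil H, the following chain of inequalities holds: rk_F(H)^k ≥ rk_F(H^{⊗k}) ≥ vrk(H^{⊗k}) ≥ vrk(H)^k. Moreover, vrk(H^{⊗k}) ≤ n^{k−1} · vrk(H). -/

import Mathlib

noncomputable section

/-- A square stencil (Bool matrix, `true` = ⋆) is visibly full rank if it has a
unique generalized diagonal of ⋆'s. -/
def VisFullRank {α : Type*} (M : Matrix α α Bool) : Prop :=
  ∃! σ : Equiv.Perm α, ∀ i, M i (σ i) = true

/-- The visible rank of a stencil: the largest `k` admitting a `k × k`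
visibly full rank sub-stencil. -/
def vrk {α β : Type*} (H : Matrix α β Bool) : ℕ :=
  sSup {k : ℕ | ∃ r : Fin k → α, ∃ c : Fin k → β,
    Function.Injective r ∧ Function.Injective c ∧
    VisFullRank (Matrix.of fun i j => H (r i) (c j))}

/-- Tensor product of stencils. -/
def stTensor {α₁ β₁ α₂ β₂ : Type*} (H₁ : Matrix α₁ β₁ Bool) (H₂ : Matrix α₂ β₂ Bool) :
    Matrix (α₁ × α₂) (β₁ × β₂) Bool :=
  Matrix.of fun a b => H₁ a.1 b.1 && H₂ a.2 b.2

/-- `k`-th tensor power of a stencil. -/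
def stPow {α β : Type*} (H : Matrix α β Bool) (k : ℕ) :
    Matrix (Fin k → α) (Fin k → β) Bool :=
  Matrix.of fun r c => decide (∀ i, H (r i) (c i) = true)

/-- `W` is an `F`-witness of the stencil `H`. -/
def IsWitness {α β F : Type*} [Field F] (H : Matrix α β Bool) (W : Matrix α β F) : Prop :=
  ∀ i j, W i j ≠ 0 ↔ H i j = true

/-- The `F`-rank of a stencil: the minimum rank of an `F`-witness. -/
def frk (F : Type*) [Field F] {α β : Type*} [Fintype β] (H : Matrix α β Bool) : ℕ :=
  sInf {r : ℕ | ∃ W : Matrix α β F, IsWitness H W ∧ W.rank = r}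

open Function in
/-- A reflexive relation on a finite type without a nontrivial generalized diagonal has, in every
nonempty finset, an element that is related to no other element of that finset. -/
theorem exists_sink_of_unique_diagonal {α : Type*} [Finite α] {R : α → α → Prop}
    (hrefl : ∀ i, R i i) (huniq : ∀ π : Equiv.Perm α, (∀ i, R i (π i)) → π = 1)
    (S : Finset α) (hS : S.Nonempty) : ∃ i ∈ S, ∀ j ∈ S, R i j → i = j := by
  classical
  by_contra! hcon
  choose g hgS hgR hgne using hcon
  let f : α → α := fun i => if h : i ∈ S then g i h else i
  have hf : ∀ i ∈ S, f i ∈ S ∧ f i ≠ i := fun i hi => by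
    simp only [f, dif_pos hi]
    exact ⟨hgS i hi, (hgne i hi).symm⟩
  have hfR : ∀ i, R i (f i) := fun i => by
    by_cases hi : i ∈ S
    · simpa only [f, dif_pos hi] using hgR i hi
    · simpa only [f, dif_neg hi] using hrefl i
  have hbij := bijOn_periodicPts f
  let φ : α → α := fun i => if i ∈ periodicPts f then f i else i
  have hφ : Injective φ := by
    intro x y hxy
    by_cases hx : x ∈ periodicPts f <;> by_cases hy : y ∈ periodicPts f <;>
      simp only [φ, hx, hy, if_true, if_false] at hxy
    · exact hbij.injOn hx hy hxy
    · exact absurd (hxy ▸ hbij.mapsTo hx) hy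
    · exact absurd (hxy ▸ hbij.mapsTo hy) hx
    · exact hxy
  obtain ⟨x, hx⟩ := hS
  have hiter : ∀ n, f^[n] x ∈ S := fun n => by
    induction n with
    | zero => exact hx
    | succ n ih => rw [iterate_succ_apply']; exact (hf _ ih).1
  obtain ⟨a, b, hab, heq⟩ : ∃ a b : ℕ, a < b ∧ f^[a] x = f^[b] x := by
    obtain ⟨a, b, hne, h⟩ := Finite.exists_ne_map_eq_of_infinite fun n => f^[n] x
    rcases lt_or_gt_of_ne hne with h' | h'
    exacts [⟨a, b, h', h⟩, ⟨b, a, h', h.symm⟩]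
  have hper : f^[a] x ∈ periodicPts f := by
    refine mk_mem_periodicPts (Nat.sub_pos_of_lt hab) ?_
    rw [IsPeriodicPt, IsFixedPt, ← iterate_add_apply, Nat.sub_add_cancel hab.le, heq]
  have hone := huniq (Equiv.ofBijective φ (Finite.injective_iff_bijective.1 hφ)) fun i => by
    by_cases hi : i ∈ periodicPts f
    · simpa [φ, hi] using hfR i
    · simpa [φ, hi] using hrefl i
  have hfix : φ (f^[a] x) = f^[a] x := congrArg (fun π : Equiv.Perm α => π (f^[a] x)) hone
  simp only [φ, hper, if_true] at hfix
  exact (hf _ (hiter a)).2 hfix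

/-- A relation for which every nonempty finset contains a sink is ranked by a natural-valued
function on each finset. -/
theorem exists_rank_of_forall_exists_sink {α : Type*} {R : α → α → Prop}
    (hsink : ∀ S : Finset α, S.Nonempty → ∃ i ∈ S, ∀ j ∈ S, R i j → i = j) (S : Finset α) :
    ∃ f : α → ℕ, ∀ i ∈ S, ∀ j ∈ S, i ≠ j → R i j → f j < f i := by
  classical
  induction S using Finset.strongInduction with
  | H S ih =>
    rcases S.eq_empty_or_nonempty with rfl | hS
    · exact ⟨0, by simp⟩
    obtain ⟨x, hx, hmin⟩ := hsink S hS
    obtain ⟨f, hf⟩ := ih (S.erase x) (Finset.erase_ssubset hx)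
    refine ⟨fun i => if i = x then 0 else f i + 1, fun i hi j hj hij hR => ?_⟩
    rcases eq_or_ne i x with rfl | hix
    · exact absurd (hmin j hj hR) hij
    · rcases eq_or_ne j x with rfl | hjx
      · simp [hix]
      · simpa [hix, hjx] using
          hf i (Finset.mem_erase.2 ⟨hix, hi⟩) j (Finset.mem_erase.2 ⟨hjx, hj⟩) hij hR

/-- The ⋆-entries at positions `(r i, c i)` form the diagonal of a sub-stencil of `H` that is
triangular with respect to the ranking `f`. -/
structure IsTriangular {α β ι : Type*} (H : Matrix α β Bool) (r : ι → α) (c : ι → β)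
    (f : ι → ℕ) : Prop where
  diag : ∀ i, H (r i) (c i) = true
  lt : ∀ i j, i ≠ j → H (r i) (c j) = true → f j < f i

namespace IsTriangular

variable {α β ι κ : Type*} {H : Matrix α β Bool} {r : ι → α} {c : ι → β} {f : ι → ℕ}

theorem comp (h : IsTriangular H r c f) {e : κ → ι} (he : Function.Injective e) :
    IsTriangular H (r ∘ e) (c ∘ e) (f ∘ e) :=
  ⟨fun i => h.diag (e i), fun i j hij => h.lt (e i) (e j) (he.ne hij)⟩

theorem injective_row (h : IsTriangular H r c f) : Function.Injective r := by
  intro i j hij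
  by_contra hne
  exact lt_asymm (h.lt i j hne (hij ▸ h.diag j)) (h.lt j i (Ne.symm hne) (hij ▸ h.diag i))

theorem injective_col (h : IsTriangular H r c f) : Function.Injective c := by
  intro i j hij
  by_contra hne
  exact lt_asymm (h.lt i j hne (hij ▸ h.diag i)) (h.lt j i (Ne.symm hne) (hij ▸ h.diag j))

theorem visFullRank [Fintype ι] (h : IsTriangular H r c f) :
    VisFullRank (Matrix.of fun i j => H (r i) (c j)) := by
  refine ⟨1, h.diag, fun π hπ => ?_⟩
  have hle : ∀ i, f (π i) ≤ f i := fun i => by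
    rcases eq_or_ne i (π i) with hi | hi
    · rw [← hi]
    · exact (h.lt i (π i) hi (hπ i)).le
  have heq := (Finset.sum_eq_sum_iff_of_le fun i _ => hle i).1 (Equiv.sum_comp π f)
  ext i
  by_contra hi
  exact (h.lt i (π i) (Ne.symm hi) (hπ i)).ne (heq i (Finset.mem_univ i))

/-- Tensor powers of triangular families are triangular. -/
theorem stPow (h : IsTriangular H r c f) (k : ℕ) :
    IsTriangular (stPow H k) (fun i : Fin k → ι => r ∘ i) (fun i => c ∘ i)
      (fun i => ∑ t, f (i t)) := by
  refine ⟨fun i => by simp [_root_.stPow, h.diag], fun i j hij hR => ?_⟩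
  simp only [_root_.stPow, Matrix.of_apply, decide_eq_true_eq, Function.comp_apply] at hR
  obtain ⟨t, ht⟩ := Function.ne_iff.1 hij
  refine Finset.sum_lt_sum (fun s _ => ?_) ⟨t, Finset.mem_univ t, h.lt _ _ ht (hR t)⟩
  rcases eq_or_ne (i s) (j s) with hs | hs
  · rw [hs]
  · exact (h.lt _ _ hs (hR s)).le

/-- A triangular family in a tensor power whose columns agree outside the first coordinate
restricts to a triangular family in the first factor. -/
theorem of_stPow_succ {k : ℕ} {r : ι → Fin (k + 1) → α} {c : ι → Fin (k + 1) → β}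
    (h : IsTriangular (_root_.stPow H (k + 1)) r c f)
    (hc : ∀ i j, Fin.tail (c i) = Fin.tail (c j)) :
    IsTriangular H (fun i => r i 0) (fun i => c i 0) f := by
  obtain ⟨hdiag, hlt⟩ := h
  simp only [_root_.stPow, Matrix.of_apply, decide_eq_true_eq] at hdiag hlt
  refine ⟨fun i => hdiag i 0, fun i j hij hR => hlt i j hij (Fin.cases hR fun t => ?_)⟩
  have ht : c j t.succ = c i t.succ := congrFun (hc j i) t
  rw [ht]
  exact hdiag i t.succ

end IsTriangular

/-- Up to reordering its columns, a visibly full rank sub-stencil is triangular. -/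
theorem VisFullRank.exists_isTriangular {α β ι : Type*} [Fintype ι] {H : Matrix α β Bool}
    {r : ι → α} {c : ι → β} (h : VisFullRank (Matrix.of fun i j => H (r i) (c j))) :
    ∃ (c' : ι → β) (f : ι → ℕ), IsTriangular H r c' f := by
  obtain ⟨σ, hσ, huniq⟩ := h
  obtain ⟨f, hf⟩ := exists_rank_of_forall_exists_sink
    (exists_sink_of_unique_diagonal (R := fun i j => H (r i) (c (σ j)) = true) hσ
      fun π hπ => mul_eq_left.1 (huniq (σ * π) hπ)) Finset.univ
  exact ⟨c ∘ σ, f, hσ, fun i j => hf i (Finset.mem_univ i) j (Finset.mem_univ j)⟩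

theorem bddAbove_visFullRank_sizes {α β : Type*} [Fintype α] (H : Matrix α β Bool) :
    BddAbove {k : ℕ | ∃ r : Fin k → α, ∃ c : Fin k → β,
      Function.Injective r ∧ Function.Injective c ∧
      VisFullRank (Matrix.of fun i j => H (r i) (c j))} :=
  ⟨Fintype.card α, fun k ⟨r, _, hr, _⟩ => by simpa using Fintype.card_le_of_injective r hr⟩

/-- The visible rank is attained. -/
theorem exists_visFullRank_vrk {α β : Type*} [Fintype α] (H : Matrix α β Bool) :
    ∃ r : Fin (vrk H) → α, ∃ c : Fin (vrk H) → β,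
      VisFullRank (Matrix.of fun i j => H (r i) (c j)) := by
  obtain ⟨r, c, -, -, h⟩ := Nat.sSup_mem (s := {k : ℕ | ∃ r : Fin k → α, ∃ c : Fin k → β,
    Function.Injective r ∧ Function.Injective c ∧
    VisFullRank (Matrix.of fun i j => H (r i) (c j))})
    ⟨0, Fin.elim0, Fin.elim0, fun i => i.elim0, fun i => i.elim0, 1, fun i => i.elim0,
      fun _ _ => Subsingleton.elim _ _⟩ (bddAbove_visFullRank_sizes H)
  exact ⟨r, c, h⟩

theorem exists_isTriangular_vrk {α β : Type*} [Fintype α] (H : Matrix α β Bool) :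
    ∃ (r : Fin (vrk H) → α) (c : Fin (vrk H) → β) (f : Fin (vrk H) → ℕ),
      IsTriangular H r c f := by
  obtain ⟨r, c, h⟩ := exists_visFullRank_vrk H
  exact ⟨r, h.exists_isTriangular⟩

theorem IsTriangular.card_le_vrk {α β ι : Type*} [Fintype α] [Fintype ι] {H : Matrix α β Bool}
    {r : ι → α} {c : ι → β} {f : ι → ℕ} (h : IsTriangular H r c f) :
    Fintype.card ι ≤ vrk H := by
  have h' := h.comp (Fintype.equivFin ι).symm.injective
  exact le_csSup (bddAbove_visFullRank_sizes H)
    ⟨_, _, h'.injective_row, h'.injective_col, h'.visFullRank⟩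

theorem vrk_pow_le_vrk_stPow {α β : Type*} [Fintype α] (H : Matrix α β Bool) (k : ℕ) :
    vrk H ^ k ≤ vrk (stPow H k) := by
  obtain ⟨r, c, f, h⟩ := exists_isTriangular_vrk H
  simpa using (h.stPow k).card_le_vrk

theorem vrk_stPow_succ_le {α β : Type*} [Fintype α] [Fintype β] (H : Matrix α β Bool) (k : ℕ) :
    vrk (stPow H (k + 1)) ≤ Fintype.card β ^ k * vrk H := by
  classical
  obtain ⟨r, c, f, h⟩ := exists_isTriangular_vrk (stPow H (k + 1))
  have hcard := Finset.card_le_mul_card_image_of_maps_to (s := Finset.univ)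
    (t := (Finset.univ : Finset (Fin k → β))) (f := fun i => Fin.tail (c i))
    (fun _ _ => Finset.mem_univ _) (vrk H) fun b _ => by
      rw [← Fintype.card_coe]
      refine ((h.comp Subtype.val_injective).of_stPow_succ fun i j => ?_).card_le_vrk
      exact (Finset.mem_filter.1 i.2).2.trans (Finset.mem_filter.1 j.2).2.symm
  simpa [mul_comm] using hcard

theorem isWitness_det_ne_zero {ι F : Type*} [Fintype ι] [DecidableEq ι] [Field F]
    {M : Matrix ι ι Bool} {W : Matrix ι ι F} (hM : VisFullRank M) (hW : IsWitness M W) :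
    W.det ≠ 0 := by
  obtain ⟨σ, hσ, huniq⟩ := hM
  rw [← Matrix.det_transpose, Matrix.det_apply, Finset.sum_eq_single σ]
  · rw [Units.smul_def, zsmul_eq_mul]
    refine mul_ne_zero ?_ (Finset.prod_ne_zero_iff.2 fun i _ => (hW _ _).2 (hσ i))
    rcases Int.units_eq_one_or (Equiv.Perm.sign σ) with h | h <;> simp [h]
  · intro π _ hπ
    obtain ⟨i, hi⟩ := not_forall.1 fun h => hπ (huniq π h)
    rw [Finset.prod_eq_zero (Finset.mem_univ i), smul_zero]
    by_contra hne
    exact hi ((hW _ _).1 hne)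
  · exact fun h => absurd (Finset.mem_univ σ) h

theorem IsWitness.vrk_le_rank {α β F : Type*} [Fintype α] [Fintype β] [Field F]
    {H : Matrix α β Bool} {W : Matrix α β F} (hW : IsWitness H W) : vrk H ≤ W.rank := by
  obtain ⟨r, c, h⟩ := exists_visFullRank_vrk H
  have hdet : (W.submatrix r c).det ≠ 0 :=
    isWitness_det_ne_zero h fun i j => hW (r i) (c j)
  simpa [Matrix.rank_of_det_ne_zero hdet] using W.rank_submatrix_le r c

/-- The `F`-rank is attained. -/
theorem exists_isWitness_rank_eq_frk (F : Type*) [Field F] {α β : Type*} [Fintype β]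
    (H : Matrix α β Bool) : ∃ W : Matrix α β F, IsWitness H W ∧ W.rank = frk F H :=
  Nat.sInf_mem (s := {r : ℕ | ∃ W : Matrix α β F, IsWitness H W ∧ W.rank = r})
    ⟨_, Matrix.of fun i j => if H i j = true then 1 else 0, fun i j => by simp, rfl⟩

theorem vrk_le_frk (F : Type*) [Field F] {α β : Type*} [Fintype α] [Fintype β]
    (H : Matrix α β Bool) : vrk H ≤ frk F H := by
  obtain ⟨W, hW, hr⟩ := exists_isWitness_rank_eq_frk F H
  exact hr ▸ hW.vrk_le_rank

theorem Matrix.exists_mul_eq_of_rank {α β F : Type*} [Fintype β] [Field F] (W : Matrix α β F) :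
    ∃ (A : Matrix α (Fin W.rank) F) (B : Matrix (Fin W.rank) β F), A * B = W := by
  have : Module.Finite F (Submodule.span F (Set.range W.col)) :=
    Module.Finite.span_of_finite F (Set.finite_range _)
  let b := Module.finBasisOfFinrankEq F (Submodule.span F (Set.range W.col))
    W.rank_eq_finrank_span_cols.symm
  refine ⟨Matrix.of fun i t => (b t : α → F) i,
    Matrix.of fun t j => b.repr ⟨W.col j, Submodule.subset_span ⟨j, rfl⟩⟩ t, ?_⟩
  ext i j
  have h := congrArg
    (fun v : Submodule.span F (Set.range W.col) => (v : α → F) i)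
    (b.sum_repr ⟨W.col j, Submodule.subset_span ⟨j, rfl⟩⟩)
  simpa [Matrix.mul_apply, mul_comm, -Module.Basis.sum_repr] using h

/-- The `k`-th Kronecker power of a matrix has rank at most the `k`-th power of the rank. -/
theorem Matrix.rank_kroneckerPow_le {α β F : Type*} [Fintype β] [Field F] (W : Matrix α β F)
    (k : ℕ) :
    (Matrix.of fun (r : Fin k → α) (c : Fin k → β) => ∏ t, W (r t) (c t)).rank ≤ W.rank ^ k := by
  classical
  obtain ⟨A, B, hAB⟩ := W.exists_mul_eq_of_rank
  have hfac : (Matrix.of fun (r : Fin k → α) (c : Fin k → β) => ∏ t, W (r t) (c t)) =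
      (Matrix.of fun (r : Fin k → α) (s : Fin k → Fin W.rank) => ∏ t, A (r t) (s t)) *
      (Matrix.of fun (s : Fin k → Fin W.rank) (c : Fin k → β) => ∏ t, B (s t) (c t)) := by
    ext r c
    have hW : ∀ i j, W i j = ∑ s, A i s * B s j := fun i j => by
      rw [← Matrix.mul_apply, hAB]
    simp only [Matrix.of_apply, Matrix.mul_apply, hW, ← Finset.prod_mul_distrib,
      Finset.prod_univ_sum, Fintype.piFinset_univ]
  rw [hfac]
  refine (Matrix.rank_mul_le_left _ _).trans ((Matrix.rank_le_card_width _).trans ?_)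
  simp

theorem frk_stPow_le (F : Type*) [Field F] {α β : Type*} [Fintype β] (H : Matrix α β Bool)
    (k : ℕ) : frk F (stPow H k) ≤ frk F H ^ k := by
  obtain ⟨W, hW, hr⟩ := exists_isWitness_rank_eq_frk F H
  rw [← hr]
  refine le_trans (Nat.sInf_le ⟨_, fun r c => ?_, rfl⟩) (W.rank_kroneckerPow_le k)
  simp [stPow, Finset.prod_ne_zero_iff, hW _ _]

/-- For `k ≥ 1`: `rk_F(H)^k ≥ rk_F(H^{⊗k}) ≥ vrk(H^{⊗k}) ≥ vrk(H)^k`, and moreover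
`vrk(H^{⊗k}) ≤ n^{k-1} · vrk(H)`. -/
theorem stmt16 (k : ℕ) (hk : 1 ≤ k) (F : Type*) [Field F] (m n : ℕ)
    (H : Matrix (Fin m) (Fin n) Bool) :
    frk F (stPow H k) ≤ frk F H ^ k ∧
    vrk (stPow H k) ≤ frk F (stPow H k) ∧
    vrk H ^ k ≤ vrk (stPow H k) ∧
    vrk (stPow H k) ≤ n ^ (k - 1) * vrk H := by
  refine ⟨frk_stPow_le F H k, vrk_le_frk F _, vrk_pow_le_vrk_stPow H k, ?_⟩
  obtain ⟨k, rfl⟩ := Nat.exists_eq_add_of_le' hk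
  simpa using vrk_stPow_succ_le H k
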